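/- arXiv:2602.21525 — 2 statements merged into one kernel-verified Lean document; each statement's English description precedes it below -/
import Mathlib

section
/- Let m ≥ 1, d ≥ 1, and g : Fin m → ℝ, and define ḡ = max_{i} |g(i)|. For y : Fin m → [0,1]^d, define F(y) = Σ_{j} g(j) • y(j) ∈ ℝ^d. Then the supremum, over all indices i ∈ Fin m and all pairs y, ỹ : Fin m → [0,1]^d with y(j) = ỹ(j) for every j ≠ i, of the Euclidean norm ‖F(y) − F(ỹ)‖₂ equals √d · ḡ. -/
open MeasureTheory

/-- Changing a single vector changes a weighted sum by the weighted change of that vector. -/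
lemma sum_smul_sub_sum_smul_of_eq_off {ι R M : Type*} [Fintype ι] [Ring R] [AddCommGroup M]
    [Module R M] (g : ι → R) {y y' : ι → M} (i : ι) (h : ∀ j, j ≠ i → y j = y' j) :
    (∑ j, g j • y j) - (∑ j, g j • y' j) = g i • (y i - y' i) := by
  rw [← Finset.sum_sub_distrib, Finset.sum_eq_single i]
  · rw [smul_sub]
  · intro j _ hj
    rw [h j hj, sub_self]
  · simp

/-- The unit cube of `ℝ^ι` has Euclidean diameter at most `√|ι|`. -/
lemma norm_sub_le_sqrt_card_of_mem_Icc {ι : Type*} [Fintype ι] {x x' : EuclideanSpace ℝ ι}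
    (hx : ∀ k, x k ∈ Set.Icc (0 : ℝ) 1) (hx' : ∀ k, x' k ∈ Set.Icc (0 : ℝ) 1) :
    ‖x - x'‖ ≤ Real.sqrt (Fintype.card ι) := by
  rw [EuclideanSpace.norm_eq]
  apply Real.sqrt_le_sqrt
  calc ∑ k, ‖(x - x') k‖ ^ 2 ≤ ∑ _k : ι, (1 : ℝ) := by
        refine Finset.sum_le_sum fun k _ => ?_
        have h : |x k - x' k| ≤ 1 :=
          abs_le.mpr ⟨by linarith [(hx k).1, (hx' k).2], by linarith [(hx k).2, (hx' k).1]⟩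
        simpa using h
    _ = Fintype.card ι := by simp

/-- ℓ₂-sensitivity of the fusion mean `F(y) = Σⱼ g(j) • y(j)` over adjacent inputs:
the supremum over all sensor indices `i` and pairs `y, y' : Fin m → [0,1]^d` differing only
in coordinate `i` of `‖F(y) − F(y')‖₂` equals `√d · ḡ`, where `ḡ = maxᵢ |g(i)|`. -/
theorem sensitivity_fusion_mean (m d : ℕ) (hm : 1 ≤ m) (hd : 1 ≤ d) (g : Fin m → ℝ) :
    sSup { r : ℝ | ∃ (i : Fin m) (y y' : Fin m → EuclideanSpace ℝ (Fin d)),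
        (∀ j k, y j k ∈ Set.Icc (0 : ℝ) 1) ∧ (∀ j k, y' j k ∈ Set.Icc (0 : ℝ) 1) ∧
        (∀ j, j ≠ i → y j = y' j) ∧
        r = ‖(∑ j, g j • y j) - (∑ j, g j • y' j)‖ }
      = Real.sqrt d * ⨆ i, |g i| := by
  have : Nonempty (Fin m) := ⟨⟨0, hm⟩⟩
  refine IsGreatest.csSup_eq ⟨?_, ?_⟩
  · obtain ⟨i, hi⟩ := exists_eq_ciSup_of_finite (f := fun i => |g i|)
    refine ⟨i, Function.update 0 i (WithLp.toLp 2 fun _ => 1), 0, ?_, by simp,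
      fun j hj => by simp [hj], ?_⟩
    · intro j k
      by_cases hj : j = i
      · subst hj
        simp
      · simp [hj]
    · rw [sum_smul_sub_sum_smul_of_eq_off g i fun j hj => by simp [hj], norm_smul, ← hi,
        mul_comm, EuclideanSpace.norm_eq]
      simp
  · rintro r ⟨i, y, y', hy, hy', h, rfl⟩
    rw [sum_smul_sub_sum_smul_of_eq_off g i h, norm_smul, mul_comm, Real.norm_eq_abs]
    have hd' := norm_sub_le_sqrt_card_of_mem_Icc (hy i) (hy' i)
    rw [Fintype.card_fin] at hd'
    exact mul_le_mul hd' (le_ciSup (f := fun i => |g i|) (Set.finite_range _).bddAbove i)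
      (abs_nonneg _) (Real.sqrt_nonneg _)
end

section
/- Let α ∈ (1, ∞), m ≥ 1, d ≥ 1, and g : Fin m → ℝ, and define ḡ = max_{i} |g(i)|. For y : Fin m → [0,1]^d, let P(y) denote the product Gaussian measure ⊗_{j=1}^d N((Σ_{i} g(i) • y(i))_j, 1) on ℝ^d, i.e., the Gaussian with mean vector Σ_{i} g(i) • y(i) and identity covariance. Then the supremum, over all indices i ∈ Fin m and all pairs y, ỹ : Fin m → [0,1]^d with y(j) = ỹ(j) for every j ≠ i, of the Rényi divergence D_α(P(y) ‖ P(ỹ)) equals (α d / 2) ḡ². -/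
open MeasureTheory ProbabilityTheory

/-- Rényi divergence of order `α` between measures `μ` and `ν`:
`D_α(μ‖ν) = (α − 1)⁻¹ log ∫ (dμ/dν)^α dν`. -/
noncomputable def renyiDiv {Ω : Type*} [MeasurableSpace Ω] (α : ℝ) (μ ν : Measure Ω) : ℝ :=
  (α - 1)⁻¹ * Real.log (∫ x, ((μ.rnDeriv ν x).toReal) ^ α ∂ν)

/-- A product of measures with real densities has the product density. -/
theorem pi_withDensity_ofReal {ι : Type*} [Fintype ι] {E : ι → Type*}
    [∀ i, MeasurableSpace (E i)] (μ : ∀ i, Measure (E i)) [∀ i, SigmaFinite (μ i)]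
    {f : ∀ i, E i → ℝ} (hf : ∀ i, Integrable (f i) (μ i)) (h0 : ∀ i x, 0 ≤ f i x) :
    Measure.pi (fun i => (μ i).withDensity fun x => ENNReal.ofReal (f i x)) =
      (Measure.pi μ).withDensity fun x => ENNReal.ofReal (∏ i, f i (x i)) := by
  refine Measure.pi_eq fun s hs => ?_
  rw [withDensity_apply _ (MeasurableSet.univ_pi hs), Measure.restrict_pi_pi,
    ← ofReal_integral_eq_lintegral_ofReal
      (Integrable.fintype_prod_dep fun i => (hf i).integrableOn)
      (Filter.Eventually.of_forall fun x => Finset.prod_nonneg fun i _ => h0 i _),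
    integral_fintype_prod_eq_prod,
    ENNReal.ofReal_prod_of_nonneg fun i _ => integral_nonneg (h0 i)]
  refine Finset.prod_congr rfl fun i _ => ?_
  rw [withDensity_apply _ (hs i), ofReal_integral_eq_lintegral_ofReal (hf i).integrableOn
    (Filter.Eventually.of_forall (h0 i))]

theorem integrable_exp_mul_sub_gaussianReal (b t c : ℝ) :
    Integrable (fun x => Real.exp (t * x - c)) (gaussianReal b 1) := by
  simp_rw [Real.exp_sub]
  exact (integrable_exp_mul_gaussianReal t).div_const _

theorem integral_exp_mul_sub_gaussianReal (b t c : ℝ) :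
    ∫ x, Real.exp (t * x - c) ∂gaussianReal b 1 = Real.exp (b * t + t ^ 2 / 2 - c) := by
  have h := congrFun (mgf_fun_id_gaussianReal (μ := b) (v := 1)) t
  simp only [mgf, NNReal.coe_one, one_mul] at h
  simp_rw [Real.exp_sub _ c, integral_div, h]

theorem gaussianReal_eq_withDensity_gaussianReal (a b : ℝ) :
    gaussianReal a 1 = (gaussianReal b 1).withDensity
      fun x => ENNReal.ofReal (Real.exp ((a - b) * x - (a ^ 2 - b ^ 2) / 2)) := by
  rw [gaussianReal_of_var_ne_zero _ one_ne_zero, gaussianReal_of_var_ne_zero _ one_ne_zero,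
    ← withDensity_mul _ (measurable_gaussianPDF _ _) (by fun_prop)]
  congr 1
  ext x
  rw [Pi.mul_apply, gaussianPDF, gaussianPDF,
    ← ENNReal.ofReal_mul (gaussianPDFReal_nonneg _ _ _), gaussianPDFReal, gaussianPDFReal,
    mul_assoc (√_)⁻¹, ← Real.exp_add]
  congr 3
  simp only [NNReal.coe_one]
  ring

theorem renyiDiv_pi_gaussianReal {ι : Type*} [Fintype ι] {α : ℝ} (hα : 1 < α) (a b : ι → ℝ) :
    renyiDiv α (Measure.pi fun k => gaussianReal (a k) 1)
      (Measure.pi fun k => gaussianReal (b k) 1) = α / 2 * ∑ k, (a k - b k) ^ 2 := by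
  have hd : Measure.pi (fun k => gaussianReal (a k) 1) =
      (Measure.pi fun k => gaussianReal (b k) 1).withDensity fun x =>
        ENNReal.ofReal (∏ k, Real.exp ((a k - b k) * x k - (a k ^ 2 - b k ^ 2) / 2)) := by
    rw [← pi_withDensity_ofReal (fun k => gaussianReal (b k) 1)
      (f := fun k x => Real.exp ((a k - b k) * x - (a k ^ 2 - b k ^ 2) / 2))
      (fun k => integrable_exp_mul_sub_gaussianReal _ _ _) (fun _ _ => (Real.exp_pos _).le)]
    simp_rw [← gaussianReal_eq_withDensity_gaussianReal]
  have hi : ∫ x, (((Measure.pi fun k => gaussianReal (a k) 1).rnDeriv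
        (Measure.pi fun k => gaussianReal (b k) 1) x).toReal) ^ α
        ∂(Measure.pi fun k => gaussianReal (b k) 1) =
      Real.exp (∑ k, α * (α - 1) / 2 * (a k - b k) ^ 2) := by
    have hr := Measure.rnDeriv_withDensity (Measure.pi fun k => gaussianReal (b k) 1)
      (f := fun x => ENNReal.ofReal
        (∏ k, Real.exp ((a k - b k) * x k - (a k ^ 2 - b k ^ 2) / 2))) (by fun_prop)
    rw [← hd] at hr
    calc
      _ = ∫ x, ∏ k, Real.exp (α * (a k - b k) * x k - α * ((a k ^ 2 - b k ^ 2) / 2))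
          ∂(Measure.pi fun k => gaussianReal (b k) 1) := by
        refine integral_congr_ae ?_
        filter_upwards [hr] with x hx
        rw [hx, ENNReal.toReal_ofReal (Finset.prod_nonneg fun _ _ => (Real.exp_pos _).le),
          ← Real.exp_sum, ← Real.exp_sum, ← Real.exp_mul, Finset.sum_mul]
        congr 1
        exact Finset.sum_congr rfl fun k _ => by ring
      _ = _ := by
        rw [integral_fintype_prod_eq_prod (f := fun k x =>
          Real.exp (α * (a k - b k) * x - α * ((a k ^ 2 - b k ^ 2) / 2)))]
        simp_rw [integral_exp_mul_sub_gaussianReal]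
        rw [← Real.exp_sum]
        congr 1
        exact Finset.sum_congr rfl fun k _ => by ring
  rw [renyiDiv, hi, Real.log_exp, ← Finset.mul_sum]
  have : α - 1 ≠ 0 := by linarith
  field_simp

theorem sum_smul_apply_sub_of_adjacent {m d : ℕ} (g : Fin m → ℝ) {i : Fin m}
    {y y' : Fin m → EuclideanSpace ℝ (Fin d)} (h : ∀ j, j ≠ i → y j = y' j) (k : Fin d) :
    (∑ i', g i' • y i') k - (∑ i', g i' • y' i') k = g i * (y i k - y' i k) := by
  rw [← PiLp.sub_apply, ← Finset.sum_sub_distrib,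
    Finset.sum_eq_single i (fun j _ hj => by rw [h j hj, sub_self]) (by simp)]
  simp only [PiLp.sub_apply, PiLp.smul_apply, smul_eq_mul]
  ring

/-- The instantaneous Rényi privacy loss of the parameterized Gaussian fusion policy:
with `P(y)` the identity-covariance Gaussian on `ℝ^d` with mean `Σᵢ g(i) • y(i)`, the
supremum over sensor indices `i` and adjacent pairs `y, y' : Fin m → [0,1]^d` (differing
only at `i`) of `D_α(P(y) ‖ P(y'))` equals `(α d / 2) ḡ²`, where `ḡ = maxᵢ |g(i)|`. -/
theorem renyi_privacy_loss_fusion (α : ℝ) (hα : 1 < α) (m d : ℕ) (hm : 1 ≤ m) (hd : 1 ≤ d)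
    (g : Fin m → ℝ) :
    sSup { r : ℝ | ∃ (i : Fin m) (y y' : Fin m → EuclideanSpace ℝ (Fin d)),
        (∀ j k, y j k ∈ Set.Icc (0 : ℝ) 1) ∧ (∀ j k, y' j k ∈ Set.Icc (0 : ℝ) 1) ∧
        (∀ j, j ≠ i → y j = y' j) ∧
        r = renyiDiv α
            (Measure.pi fun k => gaussianReal ((∑ i', g i' • y i') k) 1)
            (Measure.pi fun k => gaussianReal ((∑ i', g i' • y' i') k) 1) }
      = α * d / 2 * (⨆ i, |g i|) ^ 2 := by
  have : Nonempty (Fin m) := ⟨⟨0, hm⟩⟩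
  refine IsGreatest.csSup_eq ⟨?_, ?_⟩
  · obtain ⟨i, hi⟩ := exists_eq_ciSup_of_finite (f := fun i => |g i|)
    have hy : ∀ j, j ≠ i → (Pi.single i (WithLp.toLp 2 fun _ => 1) :
        Fin m → EuclideanSpace ℝ (Fin d)) j = (0 : Fin m → EuclideanSpace ℝ (Fin d)) j :=
      fun j hj => by simp [hj]
    refine ⟨i, Pi.single i (WithLp.toLp 2 fun _ => 1), 0, fun j k => ?_, by simp, hy, ?_⟩
    · by_cases hj : j = i
      · subst hj
        simp
      · simp [hj]
    · rw [renyiDiv_pi_gaussianReal hα]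
      simp_rw [sum_smul_apply_sub_of_adjacent g hy]
      rw [← hi, sq_abs]
      simp
      ring
  · rintro r ⟨i, y, y', hy, hy', h, rfl⟩
    rw [renyiDiv_pi_gaussianReal hα]
    simp_rw [sum_smul_apply_sub_of_adjacent g h]
    have hg : |g i| ≤ ⨆ i, |g i| := le_ciSup (f := fun i => |g i|) (Set.finite_range _).bddAbove i
    have hk : ∀ k ∈ Finset.univ, (g i * (y i k - y' i k)) ^ 2 ≤ (⨆ i, |g i|) ^ 2 := by
      intro k _
      rw [← sq_abs, abs_mul]
      have h1 : |y i k - y' i k| ≤ 1 := by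
        rw [abs_le]
        constructor <;> linarith [(hy i k).1, (hy i k).2, (hy' i k).1, (hy' i k).2]
      gcongr
      nlinarith [abs_nonneg (g i)]
    calc
      _ ≤ α / 2 * ∑ _k : Fin d, (⨆ i, |g i|) ^ 2 :=
        mul_le_mul_of_nonneg_left (Finset.sum_le_sum hk) (by linarith)
      _ = _ := by
        simp
        ring
end
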